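/- Let O be a finite set equipped with a function deg : O → ℤ. Then there exist: (i) for each ordered pair (x,y) ∈ O × O with deg y ≤ deg x, a finite set d(x,y) of cardinality deg x − deg y; and (ii) for each triple (x,y,z) with deg z ≤ deg y ≤ deg x, an injective map ι_{x,y,z} : d(x,y) ⊔ d(y,z) → d(x,z); such that for every quadruple (x,y,z,w) with deg w ≤ deg z ≤ deg y ≤ deg x, the associativity square commutes: the two composite injections d(x,y) ⊔ d(y,z) ⊔ d(z,w) → d(x,w), namely ι_{x,z,w} ∘ (ι_{x,y,z} ⊔ id_{d(z,w)}) and ι_{x,y,w} ∘ (id_{d(x,y)} ⊔ ι_{y,z,w}), are equal. -/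

import Mathlib

/-!
Statement 5: existence of index data for a finite set of objects with a degree function.
-/

/-- Given a finite set `O` with a degree function `deg : O → ℤ`, there exist finite sets
`d x y` of cardinality `deg x - deg y` (for `deg y ≤ deg x`), together with injections
`d x y ⊔ d y z ↪ d x z` satisfying the associativity condition for quadruples. -/
theorem index_data_exists (O : Type) [Fintype O] (deg : O → ℤ) :
    ∃ (d : O → O → Type) (_ : ∀ x y : O, Fintype (d x y))
      (ι : ∀ x y z : O, deg z ≤ deg y → deg y ≤ deg x → (d x y ⊕ d y z) ↪ d x z),
      (∀ x y : O, deg y ≤ deg x → Nat.card (d x y) = (deg x - deg y).toNat) ∧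
      (∀ (x y z w : O) (h1 : deg w ≤ deg z) (h2 : deg z ≤ deg y) (h3 : deg y ≤ deg x),
        (∀ a : d x y,
            ι x z w h1 (h2.trans h3) (Sum.inl (ι x y z h2 h3 (Sum.inl a))) =
            ι x y w (h1.trans h2) h3 (Sum.inl a)) ∧
        (∀ b : d y z,
            ι x z w h1 (h2.trans h3) (Sum.inl (ι x y z h2 h3 (Sum.inr b))) =
            ι x y w (h1.trans h2) h3 (Sum.inr (ι y z w h1 h2 (Sum.inl b)))) ∧
        (∀ c : d z w,
            ι x z w h1 (h2.trans h3) (Sum.inr c) =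
            ι x y w (h1.trans h2) h3 (Sum.inr (ι y z w h1 h2 (Sum.inr c))))) := by
  refine ⟨fun x y => Set.Ico (deg y) (deg x), fun _ _ => inferInstance,
    fun x y z hzy hyx =>
      ⟨Sum.elim (Set.inclusion (Set.Ico_subset_Ico_left hzy))
        (Set.inclusion (Set.Ico_subset_Ico_right hyx)),
        (Set.inclusion_injective _).sumElim (Set.inclusion_injective _) fun a b hab => ?_⟩,
    fun x y _ => by simp, fun x y z w _ _ _ => ⟨fun _ => rfl, fun _ => rfl, fun _ => rfl⟩⟩
  have hval : (a : ℤ) = b := congrArg Subtype.val hab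
  exact (a.2.1.trans_lt (hval ▸ b.2.2)).false
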